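/- Let μ be a locally finite positive Borel measure on ℝⁿ, κ ∈ ℕ, and D a dyadic grid in ℝⁿ. For all P, Q ∈ D with Q ⊊ P and all f ∈ L²(μ), the telescoping identity holds: 1_Q · Σ_{I ∈ D : Q ⊊ I ⊆ P} △^μ_{I;κ} f = E^μ_{Q;κ} f − 1_Q · E^μ_{P;κ} f, μ-almost everywhere. -/

import Mathlib

open MeasureTheory Set

noncomputable section

def cubeOf {n : ℕ} (a : Fin n → ℝ) (ℓ : ℝ) : Set (Fin n → ℝ) :=
  {x | ∀ i, x i ∈ Set.Ico (a i) (a i + ℓ)}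

def HasSideLength {n : ℕ} (Q : Set (Fin n → ℝ)) (ℓ : ℝ) : Prop :=
  ∃ a, Q = cubeOf a ℓ

def IsCube {n : ℕ} (Q : Set (Fin n → ℝ)) : Prop :=
  ∃ ℓ > (0:ℝ), HasSideLength Q ℓ

def IsDyadicGrid {n : ℕ} (D : Set (Set (Fin n → ℝ))) : Prop :=
  (∀ Q ∈ D, ∃ k : ℤ, HasSideLength Q ((2:ℝ) ^ k)) ∧
  (∀ k : ℤ, ∀ x : Fin n → ℝ, ∃! Q, Q ∈ D ∧ HasSideLength Q ((2:ℝ) ^ k) ∧ x ∈ Q) ∧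
  (∀ k : ℤ, ∀ Q ∈ D, HasSideLength Q ((2:ℝ) ^ k) →
    ∃ C : Finset (Set (Fin n → ℝ)), C.card = 2 ^ n ∧ ↑C ⊆ D ∧
      (∀ Q' ∈ C, HasSideLength Q' ((2:ℝ) ^ (k - 1))) ∧ Q = ⋃₀ ↑C)

def IsTower {n : ℕ} (D : Set (Set (Fin n → ℝ))) (Γ : ℕ → Set (Fin n → ℝ)) : Prop :=
  (∀ m, Γ m ∈ D) ∧ (∀ m, Γ m ⊆ Γ (m + 1)) ∧
  (∀ m : ℕ, HasSideLength (Γ m) ((2:ℝ) ^ (m + 1)))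

def towerTop {n : ℕ} (Γ : ℕ → Set (Fin n → ℝ)) : Set (Fin n → ℝ) := ⋃ m, Γ m

def topsOf {n : ℕ} (D : Set (Set (Fin n → ℝ))) : Set (Set (Fin n → ℝ)) :=
  {S | ∃ Γ, IsTower D Γ ∧ towerTop Γ = S}

def IsChildOf {n : ℕ} (Q' Q : Set (Fin n → ℝ)) : Prop :=
  ∃ (a : Fin n → ℝ) (ℓ : ℝ) (ε : Fin n → Bool), 0 < ℓ ∧ Q = cubeOf a ℓ ∧
    Q' = cubeOf (fun i => a i + (if ε i then ℓ / 2 else 0)) (ℓ / 2)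

def IsPolyDegLT {n : ℕ} (κ : ℕ) (p : (Fin n → ℝ) → ℝ) : Prop :=
  ∃ P : MvPolynomial (Fin n) ℝ, P.totalDegree < κ ∧ ∀ x, p x = MvPolynomial.eval x P

def monomial' {n : ℕ} (β : Fin n → ℕ) : (Fin n → ℝ) → ℝ := fun x => ∏ i, (x i) ^ (β i)

def AlpertSet {n : ℕ} (μ : Measure (Fin n → ℝ)) (Q : Set (Fin n → ℝ)) (κ : ℕ) :
    Set (Lp ℝ 2 μ) :=
  {F | ∃ f : (Fin n → ℝ) → ℝ,
      (F : (Fin n → ℝ) → ℝ) =ᵐ[μ] f ∧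
      (∀ x, x ∉ Q → f x = 0) ∧
      (∀ Q', IsChildOf Q' Q → ∃ p, IsPolyDegLT κ p ∧ ∀ x ∈ Q', f x = p x) ∧
      (∀ β : Fin n → ℕ, (∑ i, β i) < κ → ∫ x in Q, f x * monomial' β x ∂μ = 0)}

def MonomialSet {n : ℕ} (μ : Measure (Fin n → ℝ)) (S : Set (Fin n → ℝ)) (κ : ℕ) :
    Set (Lp ℝ 2 μ) :=
  {F | ∃ β : Fin n → ℕ, (∑ i, β i) < κ ∧
      (F : (Fin n → ℝ) → ℝ) =ᵐ[μ] S.indicator (monomial' β)}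

def IsOrthProjOn {n : ℕ} {μ : Measure (Fin n → ℝ)} (V : Set (Lp ℝ 2 μ))
    (P : Lp ℝ 2 μ → Lp ℝ 2 μ) : Prop :=
  ∀ f, P f ∈ V ∧ ∀ g ∈ V, inner (𝕜 := ℝ) (f - P f) g = (0:ℝ)


lemma ax_cube_sub {n : ℕ} {a b : Fin n → ℝ} {l r : ℝ} (hl : 0 < l)
    (h : cubeOf a l ⊆ cubeOf b r) (i : Fin n) : b i ≤ a i ∧ a i + l ≤ b i + r := by
  have ha : a ∈ cubeOf a l := fun j => ⟨le_rfl, by linarith⟩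
  have h1 := (h ha i)
  refine ⟨h1.1, ?_⟩
  by_contra hc
  push Not at hc
  have hx : Function.update a i (b i + r) ∈ cubeOf a l := by
    intro j
    by_cases hj : j = i
    · subst hj
      have := h1.2
      simp only [Function.update_self]
      exact ⟨by linarith, by linarith⟩
    · rw [Function.update_of_ne hj]
      exact ha j
  have := (h hx i).2
  simp at this

lemma ax_cube_meas {n : ℕ} (a : Fin n → ℝ) (l : ℝ) : MeasurableSet (cubeOf a l) := by
  have : cubeOf a l = Set.pi Set.univ (fun i => Set.Ico (a i) (a i + l)) := by
    ext x; simp [cubeOf]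
  rw [this]
  exact MeasurableSet.univ_pi (fun i => measurableSet_Ico)

lemma ax_cube_Icc {n : ℕ} (a : Fin n → ℝ) (l : ℝ) :
    cubeOf a l ⊆ Set.Icc a (fun i => a i + l) :=
  fun _ hx => ⟨fun i => (hx i).1, fun i => (hx i).2.le⟩

lemma ax_side_unique {n : ℕ} (i : Fin n) {Q : Set (Fin n → ℝ)} {k m : ℤ}
    (h1 : HasSideLength Q ((2:ℝ) ^ k)) (h2 : HasSideLength Q ((2:ℝ) ^ m)) : k = m := by
  obtain ⟨a, ha⟩ := h1
  obtain ⟨b, hb⟩ := h2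
  have e := ha.symm.trans hb
  have h1 := ax_cube_sub (by positivity) e.subset i
  have h2 := ax_cube_sub (by positivity) e.symm.subset i
  have : (2:ℝ) ^ k = (2:ℝ) ^ m := by linarith
  exact zpow_right_injective₀ (by norm_num) (by norm_num) this

lemma ax_side_le {n : ℕ} (i : Fin n) {Q R : Set (Fin n → ℝ)} {k m : ℤ}
    (h1 : HasSideLength Q ((2:ℝ) ^ k)) (h2 : HasSideLength R ((2:ℝ) ^ m)) (h : Q ⊆ R) :
    k ≤ m := by
  obtain ⟨a, rfl⟩ := h1
  obtain ⟨b, rfl⟩ := h2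
  have h1 := ax_cube_sub (by positivity) h i
  have : (2:ℝ) ^ k ≤ (2:ℝ) ^ m := by linarith
  exact (zpow_le_zpow_iff_right₀ (by norm_num)).1 this

lemma ax_side_nonempty {n : ℕ} {Q : Set (Fin n → ℝ)} {k : ℤ}
    (h1 : HasSideLength Q ((2:ℝ) ^ k)) : Q.Nonempty := by
  obtain ⟨a, rfl⟩ := h1
  have : (0:ℝ) < 2 ^ k := by positivity
  exact ⟨a, fun j => ⟨le_rfl, by linarith⟩⟩

lemma ax_nested {n : ℕ} {D : Set (Set (Fin n → ℝ))} (hD : IsDyadicGrid D) (m : ℕ) :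
    ∀ (k : ℤ) (Q R : Set (Fin n → ℝ)), Q ∈ D → R ∈ D → HasSideLength Q ((2:ℝ) ^ k) →
      HasSideLength R ((2:ℝ) ^ (k + m)) → ∀ x, x ∈ Q → x ∈ R → Q ⊆ R := by
  induction m with
  | zero =>
    intro k Q R hQ hR h1 h2 x hx hx'
    obtain ⟨S, -, hS⟩ := hD.2.1 k x
    have e1 := hS Q ⟨hQ, h1, hx⟩
    have e2 := hS R ⟨hR, by simpa using h2, hx'⟩
    rw [e1, e2]
  | succ m ih =>
    intro k Q R hQ hR h1 h2 x hx hx'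
    obtain ⟨C, -, hCD, hC, hU⟩ := hD.2.2 _ R hR h2
    have hx2 := hx'
    rw [hU] at hx2
    obtain ⟨R', hR', hxR'⟩ := hx2
    have hs := hC R' hR'
    have e : k + ((m + 1 : ℕ) : ℤ) - 1 = k + m := by push_cast; ring
    rw [e] at hs
    have := ih k Q R' hQ (hCD hR') h1 hs x hx hxR'
    refine this.trans ?_
    rw [hU]
    exact Set.subset_sUnion_of_mem hR'

lemma ax_child {n : ℕ} {D : Set (Set (Fin n → ℝ))} (hD : IsDyadicGrid D) {k : ℤ}
    {R : Set (Fin n → ℝ)} {C : Finset (Set (Fin n → ℝ))} (hR : HasSideLength R ((2:ℝ) ^ k))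
    (hCD : ↑C ⊆ D) (hC : ∀ Q' ∈ C, HasSideLength Q' ((2:ℝ) ^ (k - 1))) (hU : R = ⋃₀ ↑C)
    {J : Set (Fin n → ℝ)} (hJ : J ∈ C) : IsChildOf J R := by
  obtain ⟨a, ha⟩ := hR
  have hl : (0:ℝ) < 2 ^ k := by positivity
  have e : (2:ℝ) ^ (k - 1) = 2 ^ k / 2 := by
    rw [zpow_sub_one₀ (by norm_num)]; ring
  rw [e] at hC
  obtain ⟨b, hb⟩ := hC J hJ
  have hsub : ∀ S ∈ C, S ⊆ cubeOf a (2 ^ k) := by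
    intro S hS
    rw [← ha, hU]
    exact Set.subset_sUnion_of_mem hS
  have hbJ : b ∈ J := by rw [hb]; exact fun j => ⟨le_rfl, by linarith⟩
  have key : ∀ i, b i = a i ∨ b i = a i + 2 ^ k / 2 := by
    intro i
    have hJs := ax_cube_sub (by positivity) (hb ▸ hsub J hJ) i
    by_contra hcon
    push Not at hcon
    have hlt1 : a i < b i := lt_of_le_of_ne hJs.1 (Ne.symm hcon.1)
    have hlt2 : b i < a i + 2 ^ k / 2 := lt_of_le_of_ne (by linarith) hcon.2
    have hbR : b ∈ cubeOf a (2 ^ k) := hsub J hJ hbJ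
    have hx : Function.update b i (a i) ∈ cubeOf a (2 ^ k) := by
      intro j
      by_cases hj : j = i
      · subst hj
        simp [hl]
      · rw [Function.update_of_ne hj]
        exact hbR j
    rw [← ha, hU] at hx
    obtain ⟨S, hS, hxS⟩ := hx
    obtain ⟨c, hc⟩ := hC S hS
    have hSs := ax_cube_sub (by positivity) (hc ▸ hsub S hS) i
    rw [hc] at hxS
    have hci := (hxS i).1
    simp only [Function.update_self] at hci
    have hci : c i = a i := le_antisymm hci hSs.1
    have hbS : b ∈ S := by
      rw [hc]
      intro j
      by_cases hj : j = i
      · subst hj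
        rw [hci]
        exact ⟨hlt1.le, hlt2⟩
      · have := hxS j
        rwa [Function.update_of_ne hj] at this
    obtain ⟨T, -, hT⟩ := hD.2.1 (k - 1) b
    have e1 := hT S ⟨hCD hS, ⟨c, by rw [e]; exact hc⟩, hbS⟩
    have e2 := hT J ⟨hCD hJ, ⟨b, by rw [e]; exact hb⟩, hbJ⟩
    have e3 : cubeOf b (2 ^ k / 2) = cubeOf c (2 ^ k / 2) := by
      rw [← hb, ← hc, e1, e2]
    have := ax_cube_sub (by positivity) e3.subset i
    have := ax_cube_sub (by positivity) e3.symm.subset i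
    linarith
  classical
  refine ⟨a, 2 ^ k, fun i => decide (b i ≠ a i), hl, ha, ?_⟩
  rw [hb]
  congr 1
  funext i
  by_cases h : b i = a i
  · simp [h]
  · simp [h, (key i).resolve_left h]

lemma ax_child_eq_or {n : ℕ} {J J' R : Set (Fin n → ℝ)} (h : IsChildOf J R)
    (h' : IsChildOf J' R) : J' = J ∨ ∀ x ∈ J', x ∉ J := by
  obtain ⟨a, l, ε, hl, hR, hJ⟩ := h
  obtain ⟨a', l', ε', hl', hR', hJ'⟩ := h'
  have e := hR.symm.trans hR'
  have h1 := fun i => ax_cube_sub hl e.subset i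
  have h2 := fun i => ax_cube_sub hl' e.symm.subset i
  have ea : ∀ i, a' i = a i := fun i => le_antisymm (h1 i).1 (h2 i).1
  have el : ∀ i : Fin n, l' = l := fun i => by
    have := h1 i; have := h2 i; linarith
  by_cases hε : ε = ε'
  · left
    subst hε
    rw [hJ, hJ']
    ext x
    simp only [cubeOf, Set.mem_setOf_eq]
    refine forall_congr' fun i => ?_
    rw [ea i, el i]
  · right
    obtain ⟨i, hi⟩ := Function.ne_iff.1 hε
    intro x hx hxJ
    rw [hJ'] at hx
    rw [hJ] at hxJ
    have h3 := hx i
    have h4 := hxJ i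
    simp only [ea i, el i, Set.mem_Ico] at h3 h4
    cases h5 : ε i <;> cases h6 : ε' i <;> simp [h5, h6] at h3 h4 hi <;> linarith

lemma ax_child_sub {n : ℕ} {J R : Set (Fin n → ℝ)} (h : IsChildOf J R) : J ⊆ R := by
  obtain ⟨a, l, ε, hl, hR, hJ⟩ := h
  rw [hR, hJ]
  intro x hx i
  have := hx i
  simp only [Set.mem_Ico] at this ⊢
  cases h5 : ε i <;> simp [h5] at this <;> constructor <;> linarith

lemma ax_memLp {n : ℕ} {μ : Measure (Fin n → ℝ)} [IsLocallyFiniteMeasure μ]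
    (a : Fin n → ℝ) (l : ℝ) {g : (Fin n → ℝ) → ℝ} (hg : Continuous g) :
    MemLp ((cubeOf a l).indicator g) 2 μ := by
  rw [memLp_indicator_iff_restrict (ax_cube_meas a l)]
  obtain ⟨C, hC⟩ := (isCompact_Icc (a := a) (b := fun i => a i + l)).exists_bound_of_continuousOn
    hg.continuousOn
  have hfin : μ (cubeOf a l) < ⊤ :=
    lt_of_le_of_lt (measure_mono (ax_cube_Icc a l)) isCompact_Icc.measure_lt_top
  haveI : IsFiniteMeasure (μ.restrict (cubeOf a l)) := ⟨by simpa using hfin⟩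
  refine MemLp.of_bound hg.aestronglyMeasurable C ?_
  rw [ae_restrict_iff' (ax_cube_meas a l)]
  exact Filter.Eventually.of_forall fun x hx => hC x (ax_cube_Icc a l hx)

lemma ax_mono_cont {n : ℕ} (β : Fin n → ℕ) : Continuous (monomial' β) := by
  unfold monomial'
  fun_prop

lemma ax_mono_poly {n : ℕ} (β : Fin n → ℕ) (x : Fin n → ℝ) :
    monomial' β x = MvPolynomial.eval x
      (MvPolynomial.monomial (Finsupp.equivFunOnFinite.symm β) (1:ℝ)) := by
  rw [MvPolynomial.eval_monomial, Finsupp.prod_fintype _ _ (by simp)]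
  simp [monomial']

lemma ax_span_poly {n : ℕ} {μ : Measure (Fin n → ℝ)} {S : Set (Fin n → ℝ)} {κ : ℕ}
    (hκ : 0 < κ) {F : Lp ℝ 2 μ} (hF : F ∈ Submodule.span ℝ (MonomialSet μ S κ)) :
    ∃ p : MvPolynomial (Fin n) ℝ, p.totalDegree < κ ∧
      (F : (Fin n → ℝ) → ℝ) =ᵐ[μ] S.indicator (fun x => MvPolynomial.eval x p) := by
  induction hF using Submodule.span_induction with
  | mem F h =>
    obtain ⟨β, hβ, hF⟩ := h
    refine ⟨MvPolynomial.monomial (Finsupp.equivFunOnFinite.symm β) (1:ℝ), ?_, ?_⟩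
    · rw [MvPolynomial.totalDegree_monomial _ one_ne_zero, Finsupp.sum_fintype _ _ (by simp)]
      simpa using hβ
    · simpa only [← ax_mono_poly] using hF
  | zero =>
    refine ⟨0, by simpa using hκ, ?_⟩
    filter_upwards [Lp.coeFn_zero ℝ 2 μ] with x hx
    rw [hx]
    simp
  | add F G _ _ h1 h2 =>
    obtain ⟨p, hp, h1⟩ := h1
    obtain ⟨q, hq, h2⟩ := h2
    refine ⟨p + q, (MvPolynomial.totalDegree_add p q).trans_lt (max_lt hp hq), ?_⟩
    filter_upwards [Lp.coeFn_add F G, h1, h2] with x h0 h1 h2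
    rw [h0, Pi.add_apply, h1, h2]
    by_cases hx : x ∈ S <;> simp [hx]
  | smul c F _ h1 =>
    obtain ⟨p, hp, h1⟩ := h1
    refine ⟨c • p, (MvPolynomial.totalDegree_smul_le c p).trans_lt hp, ?_⟩
    filter_upwards [Lp.coeFn_smul c F, h1] with x h0 h1
    rw [h0, Pi.smul_apply, h1]
    by_cases hx : x ∈ S <;> simp [hx]

lemma ax_poly_span {n : ℕ} {μ : Measure (Fin n → ℝ)} [IsLocallyFiniteMeasure μ]
    (a : Fin n → ℝ) (l : ℝ) {κ : ℕ} {F : Lp ℝ 2 μ} {p : MvPolynomial (Fin n) ℝ}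
    (hp : p.totalDegree < κ)
    (hF : (F : (Fin n → ℝ) → ℝ) =ᵐ[μ] (cubeOf a l).indicator (fun x => MvPolynomial.eval x p)) :
    F ∈ Submodule.span ℝ (MonomialSet μ (cubeOf a l) κ) := by
  have e : F = ∑ d ∈ p.support, p.coeff d • (ax_memLp (μ := μ) a l (ax_mono_cont d)).toLp _ := by
    apply Lp.ext
    have h1 : ∀ᵐ x ∂μ, ∀ d : Fin n →₀ ℕ,
        (p.coeff d • (ax_memLp (μ := μ) a l (ax_mono_cont d)).toLp _ : Lp ℝ 2 μ) x
          = p.coeff d * (cubeOf a l).indicator (monomial' d) x := by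
      rw [ae_all_iff]
      intro d
      filter_upwards [Lp.coeFn_smul (p.coeff d)
        ((ax_memLp (μ := μ) a l (ax_mono_cont d)).toLp _),
        (ax_memLp (μ := μ) a l (ax_mono_cont d)).coeFn_toLp] with x h0 h1
      rw [h0, Pi.smul_apply, h1, smul_eq_mul]
    filter_upwards [hF, h1, Lp.coeFn_finsetSum p.support
      (fun d => p.coeff d • (ax_memLp (μ := μ) a l (ax_mono_cont d)).toLp _)] with x h2 h3 h4
    rw [h2, h4]
    simp only [Finset.sum_apply, h3]
    by_cases hx : x ∈ cubeOf a l
    · simp only [hx, Set.indicator_of_mem, MvPolynomial.eval_eq', monomial']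
    · simp [hx]
  rw [e]
  refine Submodule.sum_mem _ fun d hd => Submodule.smul_mem _ _ (Submodule.subset_span ?_)
  refine ⟨d, ?_, MemLp.coeFn_toLp _⟩
  have := MvPolynomial.le_totalDegree hd
  rw [Finsupp.sum_fintype _ _ (by simp)] at this
  exact this.trans_lt hp

/-- moments as inner products -/
lemma ax_moment {n : ℕ} {μ : Measure (Fin n → ℝ)} {S : Set (Fin n → ℝ)} (hS : MeasurableSet S)
    {F G : Lp ℝ 2 μ} {f g : (Fin n → ℝ) → ℝ} (hF : (F : (Fin n → ℝ) → ℝ) =ᵐ[μ] f)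
    (hG : (G : (Fin n → ℝ) → ℝ) =ᵐ[μ] S.indicator g) :
    inner ℝ F G = ∫ x in S, f x * g x ∂μ := by
  rw [L2.inner_def, ← integral_indicator hS]
  apply integral_congr_ae
  filter_upwards [hF, hG] with x h1 h2
  rw [h1, h2]
  by_cases hx : x ∈ S <;> simp [hx, mul_comm]

lemma ax_alpert_orth {n : ℕ} {μ : Measure (Fin n → ℝ)} {S : Set (Fin n → ℝ)}
    (hS : MeasurableSet S) {κ : ℕ} {F G : Lp ℝ 2 μ} (hF : F ∈ AlpertSet μ S κ)
    (hG : G ∈ Submodule.span ℝ (MonomialSet μ S κ)) : inner ℝ F G = (0:ℝ) := by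
  obtain ⟨f, hf, -, -, hm⟩ := hF
  induction hG using Submodule.span_induction with
  | mem G h =>
    obtain ⟨β, hβ, hG⟩ := h
    rw [ax_moment hS hf hG, hm β hβ]
  | zero => simp
  | add G H _ _ h1 h2 => rw [inner_add_right, h1, h2, add_zero]
  | smul c G _ h => rw [inner_smul_right, h, mul_zero]

lemma ax_key {n : ℕ} {μ : Measure (Fin n → ℝ)} [IsLocallyFiniteMeasure μ] {κ : ℕ} (hκ : 0 < κ)
    {I J : Set (Fin n → ℝ)} (hJI : IsChildOf J I) {T EI EJ : Lp ℝ 2 μ → Lp ℝ 2 μ}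
    (hT : IsOrthProjOn (AlpertSet μ I κ) T)
    (hEI : IsOrthProjOn (Submodule.span ℝ (MonomialSet μ I κ) : Set (Lp ℝ 2 μ)) EI)
    (hEJ : IsOrthProjOn (Submodule.span ℝ (MonomialSet μ J κ) : Set (Lp ℝ 2 μ)) EJ)
    (f : Lp ℝ 2 μ) : ∀ᵐ x ∂μ, x ∈ J → T f x = EJ f x - EI f x := by
  have hsub := ax_child_sub hJI
  obtain ⟨a, l, hI⟩ : ∃ a l, I = cubeOf a l := by
    obtain ⟨a, l, ε, -, h, -⟩ := hJI; exact ⟨_, _, h⟩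
  obtain ⟨b, r, hJ⟩ : ∃ a l, J = cubeOf a l := by
    obtain ⟨a, l, ε, -, -, h⟩ := hJI; exact ⟨_, _, h⟩
  have hIm : MeasurableSet I := hI ▸ ax_cube_meas a l
  -- orthogonality to the polynomials on J
  have horth : ∀ d ∈ Submodule.span ℝ (MonomialSet μ J κ),
      inner ℝ (f - (T f + EI f)) d = (0:ℝ) := by
    intro d hd
    obtain ⟨p, hp, hdp⟩ := ax_span_poly hκ hd
    obtain ⟨hq, hqo⟩ := hEI d
    obtain ⟨q, hqd, hqp⟩ := ax_span_poly hκ hq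
    have hh : d - EI d ∈ AlpertSet μ I κ := by
      have hrep : ((d - EI d : Lp ℝ 2 μ) : (Fin n → ℝ) → ℝ) =ᵐ[μ]
          fun x => J.indicator (fun x => MvPolynomial.eval x p) x
            - I.indicator (fun x => MvPolynomial.eval x q) x := by
        filter_upwards [Lp.coeFn_sub d (EI d), hdp, hqp] with x h1 h2 h3
        rw [h1, Pi.sub_apply, h2, h3]
      refine ⟨_, hrep, ?_, ?_, ?_⟩
      · intro x hx
        have : x ∉ J := fun h => hx (hsub h)
        simp [hx, this]
      · intro J' hJ'
        have hsub' := ax_child_sub hJ'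
        rcases ax_child_eq_or hJI hJ' with rfl | hdis
        · refine ⟨fun x => MvPolynomial.eval x (p - q), ⟨p - q,
            (MvPolynomial.totalDegree_sub p q).trans_lt (max_lt hp hqd), fun _ => rfl⟩, ?_⟩
          intro x hx
          simp [hx, hsub hx]
        · refine ⟨fun x => MvPolynomial.eval x (-q), ⟨-q,
            by rwa [MvPolynomial.totalDegree_neg], fun _ => rfl⟩, ?_⟩
          intro x hx
          simp [hdis x hx, hsub' hx]
      · intro β hβ
        have hml : MemLp (I.indicator (monomial' β)) 2 μ := by
          rw [hI]; exact ax_memLp a l (ax_mono_cont β)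
        rw [← ax_moment hIm hrep hml.coeFn_toLp]
        exact hqo _ (Submodule.subset_span ⟨β, hβ, hml.coeFn_toLp⟩)
    have e : d = (d - EI d) + EI d := by abel
    rw [e, inner_add_right]
    have h1 : inner ℝ (f - (T f + EI f)) (d - EI d) = (0:ℝ) := by
      have : f - (T f + EI f) = (f - T f) - EI f := by abel
      rw [this, inner_sub_left, (hT f).2 _ hh, real_inner_comm,
        ax_alpert_orth hIm hh (hEI f).1, sub_zero]
    have h2 : inner ℝ (f - (T f + EI f)) (EI d) = (0:ℝ) := by
      have : f - (T f + EI f) = (f - EI f) - T f := by abel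
      rw [this, inner_sub_left, (hEI f).2 _ hq,
        ax_alpert_orth hIm (hT f).1 hq, sub_zero]
    rw [h1, h2, add_zero]
  obtain ⟨g, hTg, -, hg, -⟩ := (hT f).1
  obtain ⟨_, ⟨p, hp, hpe⟩, hgp⟩ := hg J hJI
  obtain ⟨q, hq, hqe⟩ := ax_span_poly hκ (hEI f).1
  have hml : MemLp (J.indicator (fun x => MvPolynomial.eval x (p + q))) 2 μ := by
    rw [hJ]; exact ax_memLp b r (MvPolynomial.continuous_eval _)
  set u : Lp ℝ 2 μ := hml.toLp _ with hu
  have hue : (u : (Fin n → ℝ) → ℝ) =ᵐ[μ] J.indicator (fun x => MvPolynomial.eval x (p + q)) :=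
    hml.coeFn_toLp
  have huV : u ∈ Submodule.span ℝ (MonomialSet μ J κ) := by
    have h0 := hue
    rw [hJ] at h0 ⊢
    exact ax_poly_span b r ((MvPolynomial.totalDegree_add p q).trans_lt (max_lt hp hq)) h0
  have hon : ∀ᵐ x ∂μ, x ∈ J → u x = T f x + EI f x := by
    filter_upwards [hue, hTg, hqe] with x h1 h2 h3 hx
    rw [h1, h2, h3, hgp x hx, hpe]
    simp [hx, hsub hx]
  have hdV : u - EJ f ∈ Submodule.span ℝ (MonomialSet μ J κ) :=
    Submodule.sub_mem _ huV (hEJ f).1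
  obtain ⟨s, -, hs⟩ := ax_span_poly hκ hdV
  have h3 : inner ℝ (u - (T f + EI f)) (u - EJ f) = (0:ℝ) := by
    rw [L2.inner_def]
    apply integral_eq_zero_of_ae
    filter_upwards [hs, hon, Lp.coeFn_sub u (T f + EI f), Lp.coeFn_add (T f) (EI f)]
      with x h1 h2 h3 h4
    by_cases hx : x ∈ J
    · have : (u - (T f + EI f) : Lp ℝ 2 μ) x = 0 := by
        rw [h3, Pi.sub_apply, h4, Pi.add_apply, h2 hx, sub_self]
      rw [this]; simp
    · rw [h1]; simp [hx]
  have h0 : u - EJ f = 0 := by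
    rw [← inner_self_eq_zero (𝕜 := ℝ)]
    have e : u - EJ f = (f - EJ f) - (f - (T f + EI f)) + (u - (T f + EI f)) := by abel
    have : inner ℝ ((f - EJ f) - (f - (T f + EI f)) + (u - (T f + EI f))) (u - EJ f) = (0:ℝ) := by
      rw [inner_add_left, inner_sub_left, h3, horth _ hdV, (hEJ f).2 _ hdV]; simp
    rwa [← e] at this
  have h0 : u = EJ f := sub_eq_zero.1 h0
  filter_upwards [hon] with x hx hxJ
  rw [← h0, hx hxJ]; ring

lemma ax_kappa {n : ℕ} {μ : Measure (Fin n → ℝ)} {κ : ℕ} {I : Set (Fin n → ℝ)} {k : ℤ}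
    (hI : HasSideLength I ((2:ℝ) ^ k)) {F : Lp ℝ 2 μ} (hF : F ∈ AlpertSet μ I κ) : 0 < κ := by
  obtain ⟨f, -, -, h, -⟩ := hF
  obtain ⟨a, ha⟩ := hI
  obtain ⟨p, ⟨q, hq, -⟩, -⟩ := h _ ⟨a, 2 ^ k, fun _ => false, by positivity, ha, rfl⟩
  exact lt_of_le_of_lt (Nat.zero_le _) hq

lemma ax_chain {n : ℕ} (i0 : Fin n) {μ : Measure (Fin n → ℝ)}
    [IsLocallyFiniteMeasure μ] {κ : ℕ} (hκ : 0 < κ) {D : Set (Set (Fin n → ℝ))}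
    (hD : IsDyadicGrid D)
    {Δ : Set (Fin n → ℝ) → Lp ℝ 2 μ → Lp ℝ 2 μ}
    (hΔ : ∀ Q ∈ D, IsOrthProjOn (AlpertSet μ Q κ) (Δ Q))
    {E : Set (Fin n → ℝ) → Lp ℝ 2 μ → Lp ℝ 2 μ}
    (hE : ∀ Q ∈ D, IsOrthProjOn
      (Submodule.span ℝ (MonomialSet μ Q κ) : Set (Lp ℝ 2 μ)) (E Q))
    {Q : Set (Fin n → ℝ)} (hQ : Q ∈ D) {k : ℤ} (hk : HasSideLength Q ((2:ℝ) ^ k))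
    (f : Lp ℝ 2 μ) (m : ℕ) :
    ∀ P ∈ D, HasSideLength P ((2:ℝ) ^ (k + m)) → Q ⊆ P →
      ∃ S : Finset (Set (Fin n → ℝ)), (∀ I, I ∈ S ↔ I ∈ D ∧ Q ⊂ I ∧ I ⊆ P) ∧
        ∀ᵐ x ∂μ, x ∈ Q → (∑ I ∈ S, Δ I f : Lp ℝ 2 μ) x = E Q f x - E P f x := by
  classical
  obtain ⟨y, hy⟩ := ax_side_nonempty hk
  induction m with
  | zero =>
    intro P hP hs hQP
    have hPQ : P ⊆ Q := ax_nested hD 0 k P Q hP hQ (by simpa using hs) (by simpa using hk) y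
      (hQP hy) hy
    have e : P = Q := hPQ.antisymm hQP
    subst e
    refine ⟨∅, ?_, ?_⟩
    · intro I
      simp only [Finset.notMem_empty, false_iff]
      rintro ⟨-, h1, h2⟩
      exact h1.2 h2
    · filter_upwards [Lp.coeFn_zero ℝ 2 μ] with x hx _
      rw [Finset.sum_empty, hx]
      simp
  | succ m ih =>
    intro P hP hs hQP
    obtain ⟨C, -, hCD, hC, hU⟩ := hD.2.2 _ P hP hs
    have hyP := hQP hy
    rw [hU] at hyP
    obtain ⟨P', hP'C, hyP'⟩ := hyP
    have hP' : P' ∈ D := hCD hP'C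
    have hchild := ax_child hD hs hCD hC hU hP'C
    have hs' := hC P' hP'C
    have e : k + ((m + 1 : ℕ) : ℤ) - 1 = k + m := by push_cast; ring
    rw [e] at hs'
    have hQP' : Q ⊆ P' := ax_nested hD m k Q P' hQ hP' hk hs' y hy hyP'
    have hP'P : P' ⊆ P := ax_child_sub hchild
    have hnot : ¬ P ⊆ P' := by
      intro h
      have := ax_side_le i0 hs hs' h
      push_cast at this
      omega
    obtain ⟨S, hS, hae⟩ := ih P' hP' hs' hQP'
    have hPS : P ∉ S := fun h => hnot ((hS P).1 h).2.2
    refine ⟨insert P S, ?_, ?_⟩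
    · intro I
      rw [Finset.mem_insert, hS]
      constructor
      · rintro (rfl | ⟨h1, h2, h3⟩)
        · exact ⟨hP, ⟨hQP, fun h => hnot (h.trans hQP')⟩, subset_rfl⟩
        · exact ⟨h1, h2, h3.trans hP'P⟩
      · rintro ⟨h1, h2, h3⟩
        by_cases hIP : I = P
        · exact Or.inl hIP
        right
        refine ⟨h1, h2, ?_⟩
        obtain ⟨j, hj⟩ := hD.1 I h1
        have hjle := ax_side_le i0 hj hs h3
        have hyI : y ∈ I := h2.1 hy
        have hjne : j ≠ k + ((m + 1 : ℕ) : ℤ) := by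
          rintro rfl
          exact hIP (h3.antisymm (ax_nested hD 0 _ P I hP h1 hs (by simpa using hj) y
            (hQP hy) hyI))
        push_cast at hjle hjne
        obtain ⟨t, ht⟩ := Int.le.dest (show j ≤ k + m by omega)
        exact ax_nested hD t j I P' h1 hP' hj (by rw [ht]; exact hs') y hyI hyP'
    · rw [Finset.sum_insert hPS]
      filter_upwards [hae, ax_key hκ hchild (hΔ P hP) (hE P hP) (hE P' hP') f,
        Lp.coeFn_add (Δ P f) (∑ I ∈ S, Δ I f)] with x h1 h2 h3 hx
      rw [h3, Pi.add_apply, h1 hx, h2 (hQP' hx)]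
      ring

/-- Telescoping identity: for cubes `Q ⊊ P` of the grid `D`,
`1_Q · Σ_{I ∈ D : Q ⊊ I ⊆ P} △^μ_{I;κ} f = E^μ_{Q;κ} f − 1_Q · E^μ_{P;κ} f` `μ`-a.e. -/
theorem alpert_telescoping (n : ℕ) (μ : Measure (Fin n → ℝ))
    [IsLocallyFiniteMeasure μ] (κ : ℕ) (D : Set (Set (Fin n → ℝ))) (hD : IsDyadicGrid D)
    (Δ : Set (Fin n → ℝ) → Lp ℝ 2 μ → Lp ℝ 2 μ)
    (hΔ : ∀ Q ∈ D, IsOrthProjOn (AlpertSet μ Q κ) (Δ Q))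
    (E : Set (Fin n → ℝ) → Lp ℝ 2 μ → Lp ℝ 2 μ)
    (hE : ∀ Q ∈ D, IsOrthProjOn
      (Submodule.span ℝ (MonomialSet μ Q κ) : Set (Lp ℝ 2 μ)) (E Q))
    (P Q : Set (Fin n → ℝ)) (hP : P ∈ D) (hQ : Q ∈ D) (hQP : Q ⊂ P) :
    ∀ f : Lp ℝ 2 μ,
      Q.indicator
          ((∑' I : {I : Set (Fin n → ℝ) // I ∈ D ∧ Q ⊂ I ∧ I ⊆ P},
              Δ (I : Set (Fin n → ℝ)) f : Lp ℝ 2 μ) : (Fin n → ℝ) → ℝ)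
        =ᵐ[μ] ((E Q f : (Fin n → ℝ) → ℝ) - Q.indicator (E P f : (Fin n → ℝ) → ℝ)) := by
  classical
  intro f
  obtain ⟨k, hk⟩ := hD.1 Q hQ
  obtain ⟨j, hj⟩ := hD.1 P hP
  have hκ : 0 < κ := ax_kappa hk (hΔ Q hQ f).1
  have hn : Nonempty (Fin n) := by
    by_contra hne
    rw [not_nonempty_iff] at hne
    obtain ⟨y, hy⟩ := ax_side_nonempty hk
    refine hQP.2 fun z _ => ?_
    rwa [Subsingleton.elim z y]
  obtain ⟨i0⟩ := hn
  obtain ⟨t, ht⟩ := Int.le.dest (ax_side_le i0 hk hj hQP.1)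
  obtain ⟨S, hS, hae⟩ := ax_chain i0 hκ hD hΔ hE hQ hk f t P hP (by rw [ht]; exact hj) hQP.1
  have hsum : (∑' I : {I : Set (Fin n → ℝ) // I ∈ D ∧ Q ⊂ I ∧ I ⊆ P},
      Δ (I : Set (Fin n → ℝ)) f : Lp ℝ 2 μ) = ∑ I ∈ S, Δ I f := by
    rw [← Finset.tsum_subtype S (fun I => Δ I f)]
    exact (Equiv.subtypeEquivRight (fun I => (hS I).symm)).tsum_eq
      (fun I : {I // I ∈ S} => Δ (I : Set (Fin n → ℝ)) f)
  rw [hsum]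
  obtain ⟨p, -, hp⟩ := ax_span_poly hκ (hE Q hQ f).1
  filter_upwards [hae, hp] with x h1 h2
  by_cases hx : x ∈ Q
  · rw [Set.indicator_of_mem hx, Pi.sub_apply, Set.indicator_of_mem hx, h1 hx]
  · simp [hx, h2]

end
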